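/- For an essentially small 𝕜-linear category 𝒞 and a commutative 𝕜-algebra A, there is an isomorphism of A-modules Tr(𝒞 ⊗ A) ≅ Tr(𝒞) ⊗_𝕜 A, induced by the maps 𝒞(x,x) ⊗_𝕜 A → Tr(𝒞) ⊗_𝕜 A, f ⊗ a ↦ [f] ⊗ a. -/

import Mathlib

open CategoryTheory DirectSum TensorProduct

universe w w' v u

section ExtHomModule

variable (𝕜 : Type w) [Field 𝕜] (A : Type w') [CommRing A] [Algebra 𝕜 A]

/-- The right-multiplication `A`-module structure on `H ⊗[𝕜] A` for a `𝕜`-module `H`. -/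
noncomputable instance extHomModule (H : Type*) [AddCommGroup H] [Module 𝕜 H] :
    Module A (H ⊗[𝕜] A) :=
  { smul := fun a t => LinearMap.lTensor H (LinearMap.mulLeft 𝕜 a) t
    one_smul := fun t => by
      show LinearMap.lTensor H (LinearMap.mulLeft 𝕜 (1 : A)) t = t
      rw [LinearMap.mulLeft_one, LinearMap.lTensor_id, LinearMap.id_apply]
    mul_smul := fun a b t => by
      show LinearMap.lTensor H (LinearMap.mulLeft 𝕜 (a * b)) t
        = LinearMap.lTensor H (LinearMap.mulLeft 𝕜 a)
            (LinearMap.lTensor H (LinearMap.mulLeft 𝕜 b) t)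
      rw [LinearMap.mulLeft_mul, LinearMap.lTensor_comp, LinearMap.comp_apply]
    smul_zero := fun a => map_zero _
    smul_add := fun a t t' => map_add _ _ _
    add_smul := fun a b t => by
      have h : LinearMap.mulLeft 𝕜 (a + b) = LinearMap.mulLeft 𝕜 a + LinearMap.mulLeft 𝕜 b := by
        ext x; simp [add_mul]
      show LinearMap.lTensor H (LinearMap.mulLeft 𝕜 (a + b)) t = _
      rw [h, LinearMap.lTensor_add, LinearMap.add_apply]; rfl
    zero_smul := fun t => by
      show LinearMap.lTensor H (LinearMap.mulLeft 𝕜 (0 : A)) t = 0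
      rw [LinearMap.mulLeft_zero_eq_zero, LinearMap.lTensor_zero, LinearMap.zero_apply] }

@[simp]
lemma ext_smul_tmul {H : Type*} [AddCommGroup H] [Module 𝕜 H] (a : A) (h : H) (b : A) :
    a • (h ⊗ₜ[𝕜] b) = h ⊗ₜ[𝕜] (a * b) := by
  show LinearMap.lTensor H (LinearMap.mulLeft 𝕜 a) (h ⊗ₜ[𝕜] b) = h ⊗ₜ[𝕜] (a * b)
  simp

end ExtHomModule

section ExtCat

variable (𝕜 : Type w) [Field 𝕜] (A : Type w') [CommRing A] [Algebra 𝕜 A]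
variable (C : Type u) [Category.{v} C] [Preadditive C] [Linear 𝕜 C]

/-- The extension of scalars `𝒞 ⊗ A` of a `𝕜`-linear category `𝒞` along a commutative
`𝕜`-algebra `A`: same objects, morphism `A`-modules `(𝒞 ⊗ A)(x,y) = 𝒞(x,y) ⊗[𝕜] A`, and
composition determined bilinearly by `(f ⊗ a) ≫ (g ⊗ b) = (f ≫ g) ⊗ (a*b)`. -/
def ExtendScalarsCat (_𝕜 : Type w) (_A : Type w') (C : Type u) : Type u := C

/-- An object of `C`, viewed in `𝒞 ⊗ A`. -/
def ExtendScalarsCat.of (x : C) : ExtendScalarsCat 𝕜 A C := x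

/-- An object of `𝒞 ⊗ A`, viewed in `C`. -/
def ExtendScalarsCat.un (x : ExtendScalarsCat 𝕜 A C) : C := x

variable {C}

/-- Composition in a linear category as a bilinear map. -/
noncomputable def catCompBil (x y z : C) : (x ⟶ y) →ₗ[𝕜] (y ⟶ z) →ₗ[𝕜] (x ⟶ z) where
  toFun f := Linear.leftComp 𝕜 z f
  map_add' f g := by ext h; simp
  map_smul' c f := by ext h; simp

@[simp]
lemma catCompBil_apply {x y z : C} (f : x ⟶ y) (g : y ⟶ z) :
    catCompBil 𝕜 x y z f g = f ≫ g := rfl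

/-- The composition map of the extension of scalars category. -/
noncomputable def extComp {x y z : C} (f : (x ⟶ y) ⊗[𝕜] A) (g : (y ⟶ z) ⊗[𝕜] A) :
    (x ⟶ z) ⊗[𝕜] A :=
  TensorProduct.map (TensorProduct.lift (catCompBil 𝕜 x y z)) (LinearMap.mul' 𝕜 A)
    (TensorProduct.tensorTensorTensorComm 𝕜 (x ⟶ y) A (y ⟶ z) A (f ⊗ₜ g))

@[simp]
lemma extComp_tmul {x y z : C} (f : x ⟶ y) (a : A) (g : y ⟶ z) (b : A) :
    extComp 𝕜 A (f ⊗ₜ a) (g ⊗ₜ b) = (f ≫ g) ⊗ₜ (a * b) := by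
  simp [extComp]

lemma extComp_zero_left {x y z : C} (g : (y ⟶ z) ⊗[𝕜] A) :
    extComp 𝕜 A (0 : (x ⟶ y) ⊗[𝕜] A) g = 0 := by
  simp [extComp, zero_tmul]

lemma extComp_zero_right {x y z : C} (f : (x ⟶ y) ⊗[𝕜] A) :
    extComp 𝕜 A f (0 : (y ⟶ z) ⊗[𝕜] A) = 0 := by
  simp [extComp, tmul_zero]

lemma extComp_add_left {x y z : C} (f f' : (x ⟶ y) ⊗[𝕜] A) (g : (y ⟶ z) ⊗[𝕜] A) :
    extComp 𝕜 A (f + f') g = extComp 𝕜 A f g + extComp 𝕜 A f' g := by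
  simp [extComp, add_tmul]

lemma extComp_add_right {x y z : C} (f : (x ⟶ y) ⊗[𝕜] A) (g g' : (y ⟶ z) ⊗[𝕜] A) :
    extComp 𝕜 A f (g + g') = extComp 𝕜 A f g + extComp 𝕜 A f g' := by
  simp [extComp, tmul_add]

end ExtCat

section ExtCatInstances

variable (𝕜 : Type w) [Field 𝕜] (A : Type w') [CommRing A] [Algebra 𝕜 A]
variable {C : Type u} [Category.{v} C] [Preadditive C] [Linear 𝕜 C]

lemma extComp_id_left {x y : C} (f : (x ⟶ y) ⊗[𝕜] A) :
    extComp 𝕜 A ((𝟙 x) ⊗ₜ (1 : A)) f = f := by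
  induction f using TensorProduct.induction_on with
  | zero => exact extComp_zero_right 𝕜 A _
  | tmul g b => simp
  | add u v hu hv => rw [extComp_add_right, hu, hv]

lemma extComp_id_right {x y : C} (f : (x ⟶ y) ⊗[𝕜] A) :
    extComp 𝕜 A f ((𝟙 y) ⊗ₜ (1 : A)) = f := by
  induction f using TensorProduct.induction_on with
  | zero => exact extComp_zero_left 𝕜 A _
  | tmul g b => simp
  | add u v hu hv => rw [extComp_add_left, hu, hv]

lemma extComp_assoc {w x y z : C} (f : (w ⟶ x) ⊗[𝕜] A) (g : (x ⟶ y) ⊗[𝕜] A)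
    (h : (y ⟶ z) ⊗[𝕜] A) :
    extComp 𝕜 A (extComp 𝕜 A f g) h = extComp 𝕜 A f (extComp 𝕜 A g h) := by
  induction f using TensorProduct.induction_on with
  | zero => rw [extComp_zero_left, extComp_zero_left, extComp_zero_left]
  | tmul f₀ a =>
    induction g using TensorProduct.induction_on with
    | zero =>
      rw [extComp_zero_right, extComp_zero_left, extComp_zero_left, extComp_zero_right]
    | tmul g₀ b =>
      induction h using TensorProduct.induction_on with
      | zero => rw [extComp_zero_right, extComp_zero_right, extComp_zero_right]
      | tmul h₀ c => simp [mul_assoc]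
      | add u v hu hv =>
        rw [extComp_add_right, extComp_add_right, extComp_add_right, hu, hv]
    | add u v hu hv =>
      rw [extComp_add_right, extComp_add_left, extComp_add_left, extComp_add_right, hu, hv]
  | add u v hu hv =>
    rw [extComp_add_left, extComp_add_left, extComp_add_left, hu, hv]

noncomputable instance : Category.{max v w'} (ExtendScalarsCat 𝕜 A C) where
  Hom x y := ((ExtendScalarsCat.un 𝕜 A C x) ⟶ (ExtendScalarsCat.un 𝕜 A C y)) ⊗[𝕜] A
  id x := 𝟙 (ExtendScalarsCat.un 𝕜 A C x) ⊗ₜ 1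
  comp f g := extComp 𝕜 A f g
  id_comp f := extComp_id_left 𝕜 A f
  comp_id f := extComp_id_right 𝕜 A f
  assoc f g h := extComp_assoc 𝕜 A f g h

@[simp]
lemma extCat_comp_def {x y z : ExtendScalarsCat 𝕜 A C} (f : x ⟶ y) (g : y ⟶ z) :
    f ≫ g = extComp 𝕜 A f g := rfl

@[simp]
lemma extCat_id_def (x : ExtendScalarsCat 𝕜 A C) :
    𝟙 x = (𝟙 (ExtendScalarsCat.un 𝕜 A C x)) ⊗ₜ (1 : A) := rfl

noncomputable instance : Preadditive (ExtendScalarsCat 𝕜 A C) where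
  homGroup x y := inferInstanceAs (AddCommGroup
    (((ExtendScalarsCat.un 𝕜 A C x) ⟶ (ExtendScalarsCat.un 𝕜 A C y)) ⊗[𝕜] A))
  add_comp x y z f f' g := by
    rw [extCat_comp_def, extCat_comp_def, extCat_comp_def, extComp_add_left]
  comp_add x y z f g g' := by
    rw [extCat_comp_def, extCat_comp_def, extCat_comp_def, extComp_add_right]

lemma extComp_smul_left {x y z : C} (r : A) (f : (x ⟶ y) ⊗[𝕜] A) (g : (y ⟶ z) ⊗[𝕜] A) :
    extComp 𝕜 A (r • f) g = r • extComp 𝕜 A f g := by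
  induction f using TensorProduct.induction_on with
  | zero => rw [smul_zero, extComp_zero_left, smul_zero]
  | tmul f₀ a =>
    induction g using TensorProduct.induction_on with
    | zero => rw [extComp_zero_right, extComp_zero_right, smul_zero]
    | tmul g₀ b => rw [ext_smul_tmul, extComp_tmul, extComp_tmul, ext_smul_tmul, mul_assoc]
    | add u v hu hv => rw [extComp_add_right, extComp_add_right, smul_add, hu, hv]
  | add u v hu hv => rw [smul_add, extComp_add_left, extComp_add_left, smul_add, hu, hv]

lemma extComp_smul_right {x y z : C} (r : A) (f : (x ⟶ y) ⊗[𝕜] A) (g : (y ⟶ z) ⊗[𝕜] A) :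
    extComp 𝕜 A f (r • g) = r • extComp 𝕜 A f g := by
  induction f using TensorProduct.induction_on with
  | zero => rw [extComp_zero_left, extComp_zero_left, smul_zero]
  | tmul f₀ a =>
    induction g using TensorProduct.induction_on with
    | zero => rw [smul_zero, extComp_zero_right, smul_zero]
    | tmul g₀ b =>
      rw [ext_smul_tmul, extComp_tmul, extComp_tmul, ext_smul_tmul, mul_left_comm]
    | add u v hu hv => rw [smul_add, extComp_add_right, extComp_add_right, smul_add, hu, hv]
  | add u v hu hv => rw [extComp_add_left, extComp_add_left, smul_add, hu, hv]

noncomputable instance : Linear A (ExtendScalarsCat 𝕜 A C) where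
  homModule x y := inferInstanceAs (Module A
    (((ExtendScalarsCat.un 𝕜 A C x) ⟶ (ExtendScalarsCat.un 𝕜 A C y)) ⊗[𝕜] A))
  smul_comp _ _ _ r f g := extComp_smul_left 𝕜 A r f g
  comp_smul _ _ _ f r g := extComp_smul_right 𝕜 A r f g

end ExtCatInstances




/-- The submodule of relations `f ≫ g − g ≫ f` defining the trace of a `R`-linear category. -/
noncomputable def traceRelations (R : Type w) [CommRing R] (C : Type u) [Category.{v} C]
    [Preadditive C] [Linear R C] : Submodule R (⨁ x : C, (x ⟶ x)) :=
  letI := Classical.decEq C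
  Submodule.span R
    {a | ∃ (x y : C) (f : x ⟶ y) (g : y ⟶ x),
      a = DirectSum.of (fun z : C => (z ⟶ z)) x (f ≫ g)
            - DirectSum.of (fun z : C => (z ⟶ z)) y (g ≫ f)}

/-- The trace (zeroth Hochschild homology) of an `R`-linear category `C`:
the quotient of `⨁_{x} C(x,x)` by the span of all `f ≫ g − g ≫ f`. -/
noncomputable def Trace (R : Type w) [CommRing R] (C : Type u) [Category.{v} C]
    [Preadditive C] [Linear R C] : Type (max u v) :=
  (⨁ x : C, (x ⟶ x)) ⧸ traceRelations R C

noncomputable instance (R : Type w) [CommRing R] (C : Type u) [Category.{v} C]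
    [Preadditive C] [Linear R C] : AddCommGroup (Trace R C) :=
  inferInstanceAs (AddCommGroup ((⨁ x : C, (x ⟶ x)) ⧸ traceRelations R C))

noncomputable instance (R : Type w) [CommRing R] (C : Type u) [Category.{v} C]
    [Preadditive C] [Linear R C] : Module R (Trace R C) :=
  inferInstanceAs (Module R ((⨁ x : C, (x ⟶ x)) ⧸ traceRelations R C))

/-- The class `[f]` in the trace of an endomorphism `f : x ⟶ x`. -/
noncomputable def traceClass (R : Type w) [CommRing R] {C : Type u} [Category.{v} C]
    [Preadditive C] [Linear R C] {x : C} (f : x ⟶ x) : Trace R C :=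
  letI := Classical.decEq C
  Submodule.Quotient.mk (p := traceRelations R C) (DirectSum.of (fun z : C => (z ⟶ z)) x f)

section Statement

variable (𝕜 : Type w) [Field 𝕜] (A : Type w') [CommRing A] [Algebra 𝕜 A]
variable {C : Type u} [Category.{v} C] [Preadditive C] [Linear 𝕜 C]

/-- A pure tensor `f ⊗ a`, regarded as a morphism of the extension of scalars category. -/
noncomputable def extHom {x y : C} (f : x ⟶ y) (a : A) :
    (ExtendScalarsCat.of 𝕜 A C x ⟶ ExtendScalarsCat.of 𝕜 A C y) :=
  (f ⊗ₜ[𝕜] a : (x ⟶ y) ⊗[𝕜] A)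

/-- `traceClass` as a linear map. -/
noncomputable def traceMap (R : Type w) [CommRing R] {C : Type u} [Category.{v} C]
    [Preadditive C] [Linear R C] (x : C) : (x ⟶ x) →ₗ[R] Trace R C :=
  letI := Classical.decEq C
  (traceRelations R C).mkQ.comp (DirectSum.lof R C (fun z : C => (z ⟶ z)) x)

lemma traceMap_apply (R : Type w) [CommRing R] {C : Type u} [Category.{v} C]
    [Preadditive C] [Linear R C] {x : C} (f : x ⟶ x) : traceMap R x f = traceClass R f := rfl

lemma traceMap_cyc (R : Type w) [CommRing R] {C : Type u} [Category.{v} C]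
    [Preadditive C] [Linear R C] {x y : C} (f : x ⟶ y) (g : y ⟶ x) :
    traceMap R x (f ≫ g) = traceMap R y (g ≫ f) := by
  refine (Submodule.Quotient.eq (traceRelations R C)).2 ?_
  exact Submodule.subset_span ⟨x, y, f, g, rfl⟩

lemma trace_induction (R : Type w) [CommRing R] {C : Type u} [Category.{v} C]
    [Preadditive C] [Linear R C] {P : Trace R C → Prop} (h0 : P 0)
    (h1 : ∀ (x : C) (f : x ⟶ x), P (traceMap R x f))
    (h2 : ∀ a b, P a → P b → P (a + b)) (t : Trace R C) : P t := by
  letI := Classical.decEq C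
  obtain ⟨t, rfl⟩ := Submodule.mkQ_surjective (traceRelations R C) t
  induction t using DirectSum.induction_on with
  | zero => exact h0
  | of x f =>
    exact h1 x f
  | add a b ha hb => exact h2 _ _ ha hb

/-- Universal property of the trace. -/
lemma exists_traceLift (R : Type w) [CommRing R] {C : Type u} [Category.{v} C]
    [Preadditive C] [Linear R C] {M : Type*} [AddCommGroup M] [Module R M]
    (φ : ∀ x : C, (x ⟶ x) →ₗ[R] M)
    (h : ∀ (x y : C) (f : x ⟶ y) (g : y ⟶ x), φ x (f ≫ g) = φ y (g ≫ f)) :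
    ∃ F : Trace R C →ₗ[R] M, ∀ (x : C) (f : x ⟶ x), F (traceMap R x f) = φ x f := by
  letI := Classical.decEq C
  refine ⟨(traceRelations R C).liftQ (DirectSum.toModule R C M φ) ?_, ?_⟩
  · refine Submodule.span_le.2 ?_
    rintro _ ⟨x, y, f, g, rfl⟩
    simp only [SetLike.mem_coe, LinearMap.mem_ker, map_sub]
    rw [sub_eq_zero]
    have key : ∀ (z : C) (k : z ⟶ z), DirectSum.toModule R C M φ
        (DirectSum.of (fun z : C => (z ⟶ z)) z k) = φ z k :=
      fun z k => DirectSum.toModule_lof (M := fun z : C => (z ⟶ z)) R z k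
    exact (key x _).trans ((h x y f g).trans (key y _).symm)
  · intro x f
    exact DirectSum.toModule_lof (M := fun z : C => (z ⟶ z)) R x f

/-- For an (essentially small) `𝕜`-linear category `𝒞` and a commutative `𝕜`-algebra `A`,
there is an isomorphism of `A`-modules `Tr(𝒞 ⊗ A) ≅ Tr(𝒞) ⊗_𝕜 A`, induced by the maps
`𝒞(x,x) ⊗_𝕜 A → Tr(𝒞) ⊗_𝕜 A`, `f ⊗ a ↦ [f] ⊗ a`  (the `A`-module structure on
`Tr(𝒞) ⊗_𝕜 A` being multiplication on the right-hand tensor factor). -/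
theorem trace_extendScalars :
    ∃ e : Trace A (ExtendScalarsCat 𝕜 A C) ≃ₗ[A] (Trace 𝕜 C ⊗[𝕜] A),
      ∀ (x : C) (f : x ⟶ x) (a : A),
        e (traceClass A (extHom 𝕜 A f a)) = traceClass 𝕜 f ⊗ₜ a := by
  -- forward map
  let φ : ∀ x : ExtendScalarsCat 𝕜 A C, (x ⟶ x) →ₗ[A] (Trace 𝕜 C ⊗[𝕜] A) := fun x =>
    { toFun := LinearMap.rTensor A (traceMap 𝕜 (ExtendScalarsCat.un 𝕜 A C x))
      map_add' := fun s t => map_add _ s t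
      map_smul' := fun a t => by
        change LinearMap.rTensor A (traceMap 𝕜 (ExtendScalarsCat.un 𝕜 A C x))
            (LinearMap.lTensor _ (LinearMap.mulLeft 𝕜 a) t) =
          LinearMap.lTensor _ (LinearMap.mulLeft 𝕜 a)
            (LinearMap.rTensor A (traceMap 𝕜 (ExtendScalarsCat.un 𝕜 A C x)) t)
        rw [← LinearMap.comp_apply, ← LinearMap.comp_apply, LinearMap.rTensor_comp_lTensor,
          LinearMap.lTensor_comp_rTensor] }
  have hφ : ∀ (x : C) (t : (x ⟶ x) ⊗[𝕜] A), φ x t = LinearMap.rTensor A (traceMap 𝕜 x) t :=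
    fun _ _ => rfl
  obtain ⟨F, hF⟩ := exists_traceLift A φ (by
    intro x y f g
    change LinearMap.rTensor A (traceMap 𝕜 (ExtendScalarsCat.un 𝕜 A C x)) (extComp 𝕜 A f g) =
      LinearMap.rTensor A (traceMap 𝕜 (ExtendScalarsCat.un 𝕜 A C y)) (extComp 𝕜 A g f)
    change (ExtendScalarsCat.un 𝕜 A C x ⟶ ExtendScalarsCat.un 𝕜 A C y) ⊗[𝕜] A at f
    change (ExtendScalarsCat.un 𝕜 A C y ⟶ ExtendScalarsCat.un 𝕜 A C x) ⊗[𝕜] A at g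
    induction f using TensorProduct.induction_on with
    | zero => rw [extComp_zero_left, extComp_zero_right, map_zero, map_zero]
    | add u v hu hv => rw [extComp_add_left, extComp_add_right, map_add, map_add, hu, hv]
    | tmul f a =>
      induction g using TensorProduct.induction_on with
      | zero => rw [extComp_zero_left, extComp_zero_right, map_zero, map_zero]
      | add u v hu hv => rw [extComp_add_left, extComp_add_right, map_add, map_add, hu, hv]
      | tmul g b =>
        rw [extComp_tmul, extComp_tmul, LinearMap.rTensor_tmul, LinearMap.rTensor_tmul,
          traceMap_cyc, mul_comm])
  -- backward map
  letI : Module 𝕜 (Trace A (ExtendScalarsCat 𝕜 A C)) := Module.compHom _ (algebraMap 𝕜 A)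
  have hsm : ∀ (c : 𝕜) (t : Trace A (ExtendScalarsCat 𝕜 A C)), c • t = algebraMap 𝕜 A c • t :=
    fun _ _ => rfl
  let T : ∀ x : C, (x ⟶ x) ⊗[𝕜] A →ₗ[𝕜] Trace A (ExtendScalarsCat 𝕜 A C) := fun x =>
    { toFun := fun t => traceMap A (ExtendScalarsCat.of 𝕜 A C x) t
      map_add' := fun s t => map_add (traceMap A (ExtendScalarsCat.of 𝕜 A C x)) s t
      map_smul' := fun c t => by
        have h : c • t = algebraMap 𝕜 A c • t := by
          induction t using TensorProduct.induction_on with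
          | zero => rw [smul_zero, smul_zero]
          | add u v hu hv => rw [smul_add, smul_add, hu, hv]
          | tmul f a => rw [ext_smul_tmul, ← TensorProduct.tmul_smul, Algebra.smul_def]
        rw [h, RingHom.id_apply, hsm]
        exact map_smul (traceMap A (ExtendScalarsCat.of 𝕜 A C x)) (algebraMap 𝕜 A c) t }
  have hT : ∀ (x : C) (t : (x ⟶ x) ⊗[𝕜] A),
      T x t = traceMap A (ExtendScalarsCat.of 𝕜 A C x) t := fun _ _ => rfl
  obtain ⟨G, hG⟩ := exists_traceLift 𝕜 (C := C) (fun x => TensorProduct.curry (T x)) (by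
    intro x y f g
    ext a
    have := traceMap_cyc A (extHom 𝕜 A f a) (extHom 𝕜 A g 1)
    rw [extCat_comp_def, extCat_comp_def] at this
    unfold extHom at this
    erw [extComp_tmul, extComp_tmul, mul_one, one_mul] at this
    exact this)
  have hG' : ∀ (x : C) (f : x ⟶ x) (a : A), TensorProduct.lift G (traceMap 𝕜 x f ⊗ₜ a) =
      traceMap A (ExtendScalarsCat.of 𝕜 A C x) (extHom 𝕜 A f a) := by
    intro x f a
    rw [TensorProduct.lift.tmul, hG]
    rfl
  have hF' : ∀ (x : C) (f : x ⟶ x) (a : A),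
      F (traceMap A (ExtendScalarsCat.of 𝕜 A C x) (extHom 𝕜 A f a)) = traceMap 𝕜 x f ⊗ₜ a := by
    intro x f a
    rw [hF]
    rfl
  refine ⟨{ F with
    invFun := TensorProduct.lift G
    left_inv := ?_
    right_inv := ?_ }, fun x f a => hF' x f a⟩
  · intro t
    change TensorProduct.lift G (F t) = t
    induction t using trace_induction with
    | h0 => rw [map_zero, map_zero]
    | h2 a b ha hb => rw [map_add, map_add, ha, hb]
    | h1 x f =>
      rw [hF]
      change (ExtendScalarsCat.un 𝕜 A C x ⟶ ExtendScalarsCat.un 𝕜 A C x) ⊗[𝕜] A at f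
      change TensorProduct.lift G (LinearMap.rTensor A (traceMap 𝕜 (ExtendScalarsCat.un 𝕜 A C x)) f)
        = T (ExtendScalarsCat.un 𝕜 A C x) f
      induction f using TensorProduct.induction_on with
      | zero => simp only [map_zero]
      | add u v hu hv => simp only [map_add, hu, hv]
      | tmul f a => rw [LinearMap.rTensor_tmul, hG']; rfl
  · intro t
    change F (TensorProduct.lift G t) = t
    induction t using TensorProduct.induction_on with
    | zero => rw [map_zero, map_zero]
    | add u v hu hv => rw [map_add, map_add, hu, hv]
    | tmul t a =>
      induction t using trace_induction with
      | h0 => rw [TensorProduct.zero_tmul, map_zero, map_zero]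
      | h2 u v hu hv => rw [TensorProduct.add_tmul, map_add, map_add, hu, hv]
      | h1 x f => rw [hG', hF']

end Statement
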